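/- Let n = 2k+1 with k ≥ 1, and let M be the adjacency matrix of the middle-cube M_n. Then for every integer i with 0 ≤ i ≤ k, the matrix M² has eigenvalue (k+1−i)² with multiplicity 2·(C(n, i) − C(n, i−1)), where C(n, −1) = 0, and these account for all eigenvalues of M². -/

import Mathlib

open Finset

/-- Vertices of the middle-cube `M_n` (with `n = 2k+1`): subsets of `S = {1,…,n}`
(modeled as `Fin n`) of cardinality `k` or `k+1`. -/
abbrev MidVert (n k : ℕ) := {A : Finset (Fin n) // A.card = k ∨ A.card = k + 1}

/-- Adjacency matrix of the middle-cube: two distinct vertices `A`, `B` are adjacent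
iff `A ⊂ B` or `B ⊂ A`. -/
def midAdj (n k : ℕ) : Matrix (MidVert n k) (MidVert n k) ℝ :=
  fun A B => if A.1 ⊂ B.1 ∨ B.1 ⊂ A.1 then 1 else 0

/-- Binomial coefficient `C(n, j)` for an integer `j`, with `C(n, j) = 0` for `j < 0`. -/
def binom (n : ℕ) (j : ℤ) : ℕ := if 0 ≤ j then n.choose j.toNat else 0

section LinearAlgebra

variable {V W : Type*} [AddCommGroup V] [Module ℝ V] [AddCommGroup W] [Module ℝ W]

open Module

/-- A linear map `f` with `g ∘ f` acting as a nonzero scalar is injective on that eigenspace. -/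
lemma finrank_eigenspace_comp_le [FiniteDimensional ℝ W] (f : V →ₗ[ℝ] W) (g : W →ₗ[ℝ] V)
    {μ : ℝ} (hμ : μ ≠ 0) :
    finrank ℝ (End.eigenspace (g ∘ₗ f) μ) ≤ finrank ℝ (End.eigenspace (f ∘ₗ g) μ) := by
  have hmaps : ∀ v ∈ End.eigenspace (g ∘ₗ f) μ, f v ∈ End.eigenspace (f ∘ₗ g) μ := by
    intro v hv
    rw [End.mem_eigenspace_iff] at hv ⊢
    simp only [LinearMap.comp_apply] at hv ⊢
    rw [hv, map_smul]
  refine LinearMap.finrank_le_finrank_of_injective (f := f.restrict hmaps) ?_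
  rw [← LinearMap.ker_eq_bot, LinearMap.ker_eq_bot']
  rintro ⟨v, hv⟩ h
  have hfv : f v = 0 := congrArg Subtype.val h
  rw [End.mem_eigenspace_iff, LinearMap.comp_apply, hfv, map_zero] at hv
  exact Subtype.ext ((smul_eq_zero.mp hv.symm).resolve_left hμ)

lemma finrank_eigenspace_comp_comm [FiniteDimensional ℝ V] [FiniteDimensional ℝ W]
    (f : V →ₗ[ℝ] W) (g : W →ₗ[ℝ] V) {μ : ℝ} (hμ : μ ≠ 0) :
    finrank ℝ (End.eigenspace (g ∘ₗ f) μ) = finrank ℝ (End.eigenspace (f ∘ₗ g) μ) :=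
  (finrank_eigenspace_comp_le f g hμ).antisymm (finrank_eigenspace_comp_le g f hμ)

lemma eigenspace_add_smul_one (T : End ℝ V) (c μ : ℝ) :
    End.eigenspace (T + c • 1) (μ + c) = End.eigenspace T μ := by
  ext v
  simp [add_smul]

lemma hasEigenvalue_iff_finrank_ne_zero [FiniteDimensional ℝ V] (T : End ℝ V) (μ : ℝ) :
    T.HasEigenvalue μ ↔ finrank ℝ (End.eigenspace T μ) ≠ 0 := by
  rw [End.hasEigenvalue_iff, ne_eq, ne_eq, Submodule.finrank_eq_zero]

lemma finrank_eigenspace_prodMap [FiniteDimensional ℝ V] [FiniteDimensional ℝ W]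
    (S : End ℝ V) (T : End ℝ W) (μ : ℝ) :
    finrank ℝ (End.eigenspace (S.prodMap T : End ℝ (V × W)) μ) =
      finrank ℝ (End.eigenspace S μ) + finrank ℝ (End.eigenspace T μ) := by
  have h : End.eigenspace (S.prodMap T : End ℝ (V × W)) μ =
      (End.eigenspace S μ).prod (End.eigenspace T μ) := by
    ext ⟨v, w⟩
    simp [Submodule.mem_prod]
  let e : (End.eigenspace S μ).prod (End.eigenspace T μ) ≃ₗ[ℝ]
      End.eigenspace S μ × End.eigenspace T μ :=
    { toFun := fun x => (⟨x.1.1, x.2.1⟩, ⟨x.1.2, x.2.2⟩)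
      map_add' := fun _ _ => rfl
      map_smul' := fun _ _ => rfl
      invFun := fun x => ⟨(x.1.1, x.2.1), x.1.2, x.2.2⟩
      left_inv := fun _ => rfl
      right_inv := fun _ => rfl }
  rw [h, e.finrank_eq, finrank_prod]

lemma finrank_eigenspace_of_semiconj (S : End ℝ V) (T : End ℝ W) (e : V ≃ₗ[ℝ] W)
    (h : ∀ v, e (S v) = T (e v)) (μ : ℝ) :
    finrank ℝ (End.eigenspace S μ) = finrank ℝ (End.eigenspace T μ) := by
  have hmap : (End.eigenspace S μ).map (e : V →ₗ[ℝ] W) = End.eigenspace T μ := by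
    ext w
    obtain ⟨v, rfl⟩ := e.surjective w
    rw [Submodule.mem_map_equiv, e.symm_apply_apply, End.mem_eigenspace_iff,
      End.mem_eigenspace_iff, ← h, ← map_smul, e.injective.eq_iff]
  rw [← hmap]
  exact (LinearEquiv.finrank_map_eq e _).symm

/-- If `f ∘ g` is bijective then the kernel of `g ∘ f` is that of the surjection `f`. -/
lemma finrank_eigenspace_zero_comp [FiniteDimensional ℝ V] [FiniteDimensional ℝ W]
    (f : V →ₗ[ℝ] W) (g : W →ₗ[ℝ] V) (h : ¬ End.HasEigenvalue (f ∘ₗ g) 0) :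
    finrank ℝ (End.eigenspace (g ∘ₗ f) 0) = finrank ℝ V - finrank ℝ W := by
  rw [End.hasEigenvalue_iff, not_not, End.eigenspace_zero] at h
  have hinj : Function.Injective (f ∘ₗ g) := LinearMap.ker_eq_bot.mp h
  have hg : LinearMap.ker g = ⊥ := LinearMap.ker_eq_bot.mpr (Function.Injective.of_comp hinj)
  have hf : LinearMap.range f = ⊤ := LinearMap.range_eq_top.mpr
    (Function.Surjective.of_comp (LinearMap.injective_iff_surjective.mp hinj))
  have := LinearMap.finrank_range_add_finrank_ker f
  rw [hf, finrank_top] at this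
  rw [End.eigenspace_zero, LinearMap.ker_comp_of_ker_eq_bot _ hg]
  omega

end LinearAlgebra

section Layers

open Module Matrix

/-- The subsets of `Fin n` with `j` elements. -/
abbrev Layer (n j : ℕ) := {A : Finset (Fin n) // A.card = j}

/-- The inclusion matrix between the layers `j` and `j + 1` of the Boolean lattice. -/
def inclMatrix (n j : ℕ) : Matrix (Layer n j) (Layer n (j + 1)) ℝ :=
  fun A B => if A.1 ⊆ B.1 then 1 else 0

/-- Summation over the supersets with one more element. -/
def down (n j : ℕ) : (Layer n (j + 1) → ℝ) →ₗ[ℝ] (Layer n j → ℝ) :=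
  toLin' (inclMatrix n j)

/-- Summation over the subsets with one element less. -/
def up (n j : ℕ) : (Layer n j → ℝ) →ₗ[ℝ] (Layer n (j + 1) → ℝ) :=
  toLin' (inclMatrix n j)ᵀ

lemma card_layer_subset (n j : ℕ) (Y : Finset (Fin n)) :
    #{C : Layer n j | C.1 ⊆ Y} = (#Y).choose j := by
  rw [← card_powersetCard, ← card_map (Function.Embedding.subtype _)]
  congr 1
  ext C
  simp [mem_powersetCard]

lemma card_layer_superset (n j : ℕ) (hj : j ≤ n) (X : Finset (Fin n)) :
    #{C : Layer n j | X ⊆ C.1} = (n - #X).choose (n - j) := by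
  have h := card_layer_subset n (n - j) Xᶜ
  rw [card_compl, Fintype.card_fin] at h
  rw [← h]
  refine card_bij' (fun C _ => ⟨C.1ᶜ, by rw [card_compl, Fintype.card_fin, C.2]⟩)
    (fun C _ => ⟨C.1ᶜ, by rw [card_compl, Fintype.card_fin, C.2]; omega⟩) ?_ ?_ ?_ ?_
  · intro C hC
    simpa using hC
  · intro C hC
    simpa [subset_compl_comm] using hC
  · simp
  · simp

lemma inclMatrix_transpose_mul_apply (n j : ℕ) (A B : Layer n (j + 1)) :
    ((inclMatrix n j)ᵀ * inclMatrix n j) A B = ((#(A.1 ∩ B.1)).choose j : ℝ) := by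
  rw [← card_layer_subset, card_filter, mul_apply]
  push_cast
  refine sum_congr rfl fun C _ => ?_
  simp only [transpose_apply, inclMatrix, subset_inter_iff]
  split_ifs <;> simp_all

lemma inclMatrix_mul_transpose_apply (n j : ℕ) (hj : j + 1 ≤ n) (A B : Layer n j) :
    (inclMatrix n j * (inclMatrix n j)ᵀ) A B =
      ((n - #(A.1 ∪ B.1)).choose (n - (j + 1)) : ℝ) := by
  rw [← card_layer_superset _ _ hj, card_filter, mul_apply]
  push_cast
  refine sum_congr rfl fun C _ => ?_
  simp only [transpose_apply, inclMatrix, union_subset_iff]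
  split_ifs <;> simp_all

lemma inclMatrix_mul_transpose_succ (n j : ℕ) (hj : j + 2 ≤ n) :
    inclMatrix n (j + 1) * (inclMatrix n (j + 1))ᵀ =
      (inclMatrix n j)ᵀ * inclMatrix n j + ((n : ℝ) - 2 * j - 2) • 1 := by
  ext A B
  rw [Matrix.add_apply, Matrix.smul_apply, inclMatrix_mul_transpose_apply _ _ hj,
    inclMatrix_transpose_mul_apply]
  have hcard := card_union_add_card_inter A.1 B.1
  rw [A.2, B.2] at hcard
  by_cases hAB : A = B
  · subst hAB
    obtain ⟨m, rfl⟩ := Nat.exists_eq_add_of_le hj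
    have h1 : j + 2 + m - (j + 1) = m + 1 := by omega
    have h2 : j + 2 + m - (j + 1 + 1) = m := by omega
    simp only [union_self, inter_self, A.2, h1, h2, one_apply_eq, Nat.choose_succ_self_right]
    push_cast
    simp
    ring
  · have hlt : #(A.1 ∩ B.1) < j + 1 := by
      refine lt_of_le_of_ne ((card_le_card inter_subset_left).trans A.2.le) fun h => hAB ?_
      have hA : A.1 ∩ B.1 = A.1 := eq_of_subset_of_card_le inter_subset_left (by rw [A.2, h])
      have hB : A.1 ∩ B.1 = B.1 := eq_of_subset_of_card_le inter_subset_right (by rw [B.2, h])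
      exact Subtype.ext (hA.symm.trans hB)
    rw [one_apply_ne hAB, smul_zero, add_zero]
    norm_cast
    rcases (Nat.lt_succ_iff.mp hlt).eq_or_lt with h | h
    · have : #(A.1 ∪ B.1) = j + 1 + 1 := by omega
      rw [this, h, Nat.choose_self, Nat.choose_self]
    · have hle := card_le_univ (A.1 ∪ B.1)
      rw [Fintype.card_fin] at hle
      rw [Nat.choose_eq_zero_of_lt h, Nat.choose_eq_zero_of_lt (by omega)]

lemma down_comp_up_succ (n j : ℕ) (hj : j + 2 ≤ n) :
    down n (j + 1) ∘ₗ up n (j + 1) =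
      (up n j ∘ₗ down n j : End ℝ _) + ((n : ℝ) - 2 * j - 2) • 1 := by
  rw [down, up, up, down, ← toLin'_mul, ← toLin'_mul, inclMatrix_mul_transpose_succ n j hj,
    map_add, map_smul, toLin'_one]
  rfl

lemma down_comp_up_zero (n : ℕ) (hn : 1 ≤ n) :
    down n 0 ∘ₗ up n 0 = (n : ℝ) • (1 : End ℝ (Layer n 0 → ℝ)) := by
  have h : inclMatrix n 0 * (inclMatrix n 0)ᵀ = (n : ℝ) • 1 := by
    ext A B
    have hA : A.1 = ∅ := card_eq_zero.mp A.2
    have hAB : A = B := Subtype.ext (hA.trans (card_eq_zero.mp B.2).symm)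
    subst hAB
    obtain ⟨m, rfl⟩ := Nat.exists_eq_add_of_le' hn
    rw [inclMatrix_mul_transpose_apply _ _ hn]
    simp [hA]
  rw [down, up, ← toLin'_mul, h, map_smul, toLin'_one]
  rfl

lemma finrank_layer (n j : ℕ) : finrank ℝ (Layer n j → ℝ) = n.choose j := by
  rw [finrank_fintype_fun_eq_card, Fintype.card_finset_len, Fintype.card_fin]

/-- The eigenvalues of `down ∘ up` below the middle layer. -/
lemma exists_eq_of_hasEigenvalue_down_comp_up (n j : ℕ) (hj : 2 * j < n) (μ : ℝ)
    (hμ : End.HasEigenvalue (down n j ∘ₗ up n j) μ) :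
    ∃ i ≤ j, μ = ((j : ℝ) + 1 - i) * (n - j - i) := by
  induction j generalizing μ with
  | zero =>
    obtain ⟨v, hv⟩ := hμ.exists_hasEigenvector
    have h := hv.apply_eq_smul
    rw [down_comp_up_zero n hj] at h
    refine ⟨0, le_rfl, ?_⟩
    have := smul_left_injective ℝ hv.2 h
    simp [← this]
  | succ j ih =>
    obtain ⟨ν, rfl⟩ : ∃ ν, μ = ν + ((n : ℝ) - 2 * j - 2) := ⟨μ - (n - 2 * j - 2), by ring⟩
    rw [hasEigenvalue_iff_finrank_ne_zero, down_comp_up_succ n j (by omega),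
      eigenspace_add_smul_one] at hμ
    by_cases hν : ν = 0
    · refine ⟨j + 1, le_rfl, ?_⟩
      rw [hν]
      push_cast
      ring
    · rw [← finrank_eigenspace_comp_comm _ _ hν, ← hasEigenvalue_iff_finrank_ne_zero] at hμ
      obtain ⟨i, hi, rfl⟩ := ih (by omega) ν hμ
      refine ⟨i, by omega, ?_⟩
      push_cast
      ring

lemma layer_eigenvalue_pos {n j i : ℕ} (hj : 2 * j < n) (hi : i ≤ j) :
    0 < ((j : ℝ) + 1 - i) * (n - j - i) := by
  have h1 : (i : ℝ) ≤ j := by exact_mod_cast hi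
  have h2 : (2 : ℝ) * j < n := by exact_mod_cast hj
  exact mul_pos (by linarith) (by linarith)

lemma not_hasEigenvalue_zero_down_comp_up (n j : ℕ) (hj : 2 * j < n) :
    ¬ End.HasEigenvalue (down n j ∘ₗ up n j) 0 := by
  intro h
  obtain ⟨i, hi, h0⟩ := exists_eq_of_hasEigenvalue_down_comp_up n j hj 0 h
  exact (layer_eigenvalue_pos hj hi).ne h0

/-- The multiplicities of the eigenvalues of `down ∘ up` below the middle layer. -/
lemma finrank_eigenspace_down_comp_up (n j : ℕ) (hj : 2 * j < n) (i : ℕ) (hi : i ≤ j) :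
    finrank ℝ (End.eigenspace (down n j ∘ₗ up n j) (((j : ℝ) + 1 - i) * (n - j - i))) =
      n.choose i - binom n ((i : ℤ) - 1) := by
  induction j generalizing i with
  | zero =>
    obtain rfl : i = 0 := by omega
    have htop : End.eigenspace (down n 0 ∘ₗ up n 0) (n : ℝ) = ⊤ := by
      rw [down_comp_up_zero n hj]
      ext v
      simp
    have hval : (((0 : ℕ) : ℝ) + 1 - (0 : ℕ)) * (n - (0 : ℕ) - (0 : ℕ)) = n := by simp
    rw [hval, htop, finrank_top, finrank_layer]
    simp [binom]
  | succ j ih =>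
    rw [down_comp_up_succ n j (by omega)]
    have hshift : (((j + 1 : ℕ) : ℝ) + 1 - i) * (n - (j + 1 : ℕ) - i) =
        ((j : ℝ) + 1 - i) * (n - j - i) + ((n : ℝ) - 2 * j - 2) := by
      push_cast
      ring
    rw [hshift, eigenspace_add_smul_one]
    rcases hi.eq_or_lt with rfl | hlt
    · have h0 : ((j : ℝ) + 1 - (j + 1 : ℕ)) * (n - j - (j + 1 : ℕ)) = 0 := by simp
      rw [h0, finrank_eigenspace_zero_comp _ _
        (not_hasEigenvalue_zero_down_comp_up n j (by omega)), finrank_layer, finrank_layer]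
      simp [binom]
    · have hi' : i ≤ j := Nat.lt_succ_iff.mp hlt
      rw [← finrank_eigenspace_comp_comm _ _ (layer_eigenvalue_pos (by omega) hi').ne',
        ih (by omega) i hi']

end Layers

section MiddleCube

open Module Matrix

/-- The vertices of the middle-cube split into its two layers. -/
noncomputable def midVertEquiv (n k : ℕ) : Layer n k ⊕ Layer n (k + 1) ≃ MidVert n k :=
  Equiv.ofBijective (Sum.elim (fun A => ⟨A.1, Or.inl A.2⟩) fun A => ⟨A.1, Or.inr A.2⟩) <| by
    constructor
    · rintro (⟨A, hA⟩ | ⟨A, hA⟩) (⟨B, hB⟩ | ⟨B, hB⟩) h <;>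
        obtain rfl : A = B := congrArg Subtype.val h
      · rfl
      · omega
      · omega
      · rfl
    · rintro ⟨A, hA | hA⟩
      · exact ⟨Sum.inl ⟨A, hA⟩, rfl⟩
      · exact ⟨Sum.inr ⟨A, hA⟩, rfl⟩

lemma midAdj_submatrix_midVertEquiv (n k : ℕ) :
    (midAdj n k).submatrix (midVertEquiv n k) (midVertEquiv n k) =
      fromBlocks 0 (inclMatrix n k) (inclMatrix n k)ᵀ 0 := by
  have hlt {A B : Finset (Fin n)} (h : #B ≤ #A) : ¬ A ⊂ B :=
    fun hs => (card_lt_card hs).not_ge h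
  have hss {A B : Finset (Fin n)} (h : #A < #B) : A ⊂ B ↔ A ⊆ B :=
    ⟨fun hs => hs.subset, fun hs => hs.ssubset_of_ne fun he => by simp [he] at h⟩
  ext (⟨A, hA⟩ | ⟨A, hA⟩) (⟨B, hB⟩ | ⟨B, hB⟩)
  · change (if A ⊂ B ∨ B ⊂ A then (1 : ℝ) else 0) = 0
    simp [hlt (hA.trans hB.symm).ge, hlt (hA.trans hB.symm).le]
  · have h : #A < #B := by omega
    change (if A ⊂ B ∨ B ⊂ A then (1 : ℝ) else 0) = if A ⊆ B then 1 else 0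
    simp [hlt h.le, hss h]
  · have h : #B < #A := by omega
    change (if A ⊂ B ∨ B ⊂ A then (1 : ℝ) else 0) = if B ⊆ A then 1 else 0
    simp [hlt h.le, hss h]
  · change (if A ⊂ B ∨ B ⊂ A then (1 : ℝ) else 0) = 0
    simp [hlt (hA.trans hB.symm).ge, hlt (hA.trans hB.symm).le]

lemma midAdj_sq_submatrix_midVertEquiv (n k : ℕ) :
    (midAdj n k ^ 2).submatrix (midVertEquiv n k) (midVertEquiv n k) =
      fromBlocks (inclMatrix n k * (inclMatrix n k)ᵀ) 0 0
        ((inclMatrix n k)ᵀ * inclMatrix n k) := by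
  rw [sq, ← submatrix_mul_equiv _ _ _ (midVertEquiv n k), midAdj_submatrix_midVertEquiv,
    fromBlocks_multiply]
  simp

/-- The eigenspaces of the squared adjacency matrix split along the two layers. -/
lemma finrank_eigenspace_midAdj_sq (n k : ℕ) (μ : ℝ) :
    finrank ℝ (End.eigenspace (toLin' (midAdj n k ^ 2)) μ) =
      finrank ℝ (End.eigenspace (down n k ∘ₗ up n k) μ) +
        finrank ℝ (End.eigenspace (up n k ∘ₗ down n k) μ) := by
  rw [← finrank_eigenspace_prodMap]
  refine finrank_eigenspace_of_semiconj _ _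
    ((LinearEquiv.funCongrLeft ℝ ℝ (midVertEquiv n k)).trans
      (LinearEquiv.sumArrowLequivProdArrow _ _ ℝ ℝ)) (fun v => ?_) μ
  have h : (midAdj n k ^ 2 *ᵥ v) ∘ midVertEquiv n k =
      fromBlocks (inclMatrix n k * (inclMatrix n k)ᵀ) 0 0
        ((inclMatrix n k)ᵀ * inclMatrix n k) *ᵥ (v ∘ midVertEquiv n k) := by
    rw [← midAdj_sq_submatrix_midVertEquiv, submatrix_mulVec_equiv]
    simp [Function.comp_assoc]
  rw [fromBlocks_mulVec, zero_mulVec, zero_mulVec, add_zero, zero_add] at h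
  rw [down, up, ← toLin'_mul, ← toLin'_mul]
  ext A
  · exact congrFun h (Sum.inl A)
  · exact congrFun h (Sum.inr A)

lemma binom_pred_lt_choose {k i : ℕ} (hi : i ≤ k) :
    binom (2 * k + 1) ((i : ℤ) - 1) < (2 * k + 1).choose i := by
  cases i with
  | zero => simp [binom]
  | succ i =>
    have h := Nat.choose_succ_right_eq (2 * k + 1) i
    have hpos : 0 < (2 * k + 1).choose i := Nat.choose_pos (by omega)
    have hlt : i + 1 < 2 * k + 1 - i := by omega
    have : binom (2 * k + 1) (((i + 1 : ℕ) : ℤ) - 1) = (2 * k + 1).choose i := by simp [binom]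
    rw [this]
    by_contra! hle
    nlinarith [Nat.mul_le_mul_right (i + 1) hle, Nat.mul_lt_mul_of_pos_left hlt hpos]

end MiddleCube

/-- For `n = 2k+1` and `M` the adjacency matrix of the middle-cube `M_n`: for every
`0 ≤ i ≤ k`, `M²` has eigenvalue `(k+1−i)²` with multiplicity
`2·(C(n,i) − C(n,i−1))` (with `C(n,−1) = 0`), and these account for all eigenvalues
of `M²`. -/
theorem middle_cube_sq_eigenvalues (k : ℕ) (hk : 1 ≤ k) :
    (∀ i : ℕ, i ≤ k →
      Module.End.HasEigenvalue (Matrix.toLin' (midAdj (2 * k + 1) k ^ 2))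
        (((k : ℝ) + 1 - i) ^ 2) ∧
      Module.finrank ℝ
          (Module.End.eigenspace (Matrix.toLin' (midAdj (2 * k + 1) k ^ 2))
            (((k : ℝ) + 1 - i) ^ 2)) =
        2 * ((2 * k + 1).choose i - binom (2 * k + 1) ((i : ℤ) - 1))) ∧
    (∀ μ : ℝ, Module.End.HasEigenvalue (Matrix.toLin' (midAdj (2 * k + 1) k ^ 2)) μ →
      ∃ i : ℕ, i ≤ k ∧ μ = ((k : ℝ) + 1 - i) ^ 2) := by
  have hlayer : 2 * k < 2 * k + 1 := by omega
  have hval (i : ℕ) : ((k : ℝ) + 1 - i) ^ 2 =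
      ((k : ℝ) + 1 - i) * (((2 * k + 1 : ℕ) : ℝ) - k - i) := by
    push_cast
    ring
  have hmult (i : ℕ) (hi : i ≤ k) : Module.finrank ℝ
      (Module.End.eigenspace (Matrix.toLin' (midAdj (2 * k + 1) k ^ 2))
        (((k : ℝ) + 1 - i) ^ 2)) =
      2 * ((2 * k + 1).choose i - binom (2 * k + 1) ((i : ℤ) - 1)) := by
    rw [hval, finrank_eigenspace_midAdj_sq,
      finrank_eigenspace_comp_comm (down _ k) (up _ k) (layer_eigenvalue_pos hlayer hi).ne',
      finrank_eigenspace_down_comp_up _ _ hlayer i hi, ← two_mul]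
  refine ⟨fun i hi => ⟨?_, hmult i hi⟩, fun μ hμ => ?_⟩
  · rw [hasEigenvalue_iff_finrank_ne_zero, hmult i hi]
    have := binom_pred_lt_choose hi
    omega
  · suffices h : Module.End.HasEigenvalue
        (down (2 * k + 1) k ∘ₗ up (2 * k + 1) k) μ by
      obtain ⟨i, hi, rfl⟩ := exists_eq_of_hasEigenvalue_down_comp_up _ k hlayer μ h
      exact ⟨i, hi, (hval i).symm⟩
    rw [hasEigenvalue_iff_finrank_ne_zero, finrank_eigenspace_midAdj_sq] at hμ
    rw [hasEigenvalue_iff_finrank_ne_zero]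
    by_cases h0 : μ = 0
    · subst h0
      rw [finrank_eigenspace_zero_comp _ _
        (not_hasEigenvalue_zero_down_comp_up _ k hlayer), finrank_layer, finrank_layer,
        Nat.choose_symm_half] at hμ
      omega
    · rw [finrank_eigenspace_comp_comm (down _ k) (up _ k) h0] at hμ
      omega
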